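/- arXiv:2111.00743 — 4 statements merged into one kernel-verified Lean document; each statement's English description precedes it below -/
import Mathlib

section
/- Suppose the augmentation is a (σ,δ)-augmentation with main parts C_1^0,…,C_K^0, the encoder f is L-Lipschitz with ‖f(x)‖ = r for all x, and ε>0. Fix ℓ ∈ [K], and suppose that for all k ≠ ℓ one has μ_ℓᵀμ_k < r²·(1 − ρ_ℓ(σ,δ,ε) − √(2ρ_ℓ(σ,δ,ε)) − Δ_μ/2), where ρ_ℓ(σ,δ,ε) = 2(1−σ) + R_ε/p_ℓ + σ(Lδ/r + 2ε/r) and Δ_μ = 1 − min_{k∈[K]} ‖μ_k‖²/r². Then every x ∈ C_ℓ^0 ∩ S_ε is correctly classified by the nearest-neighbor classifier, i.e., ‖f(x)−μ_ℓ‖ < ‖f(x)−μ_k‖ for all k ≠ ℓ. -/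
open MeasureTheory

noncomputable section

/-- The augmented distance `d_A(x₁,x₂) = min_{x₁'∈A(x₁), x₂'∈A(x₂)} ‖x₁'−x₂'‖`. -/
def augDist {N : ℕ} (A : EuclideanSpace ℝ (Fin N) → Set (EuclideanSpace ℝ (Fin N)))
    (x₁ x₂ : EuclideanSpace ℝ (Fin N)) : ℝ :=
  sInf {r : ℝ | ∃ y₁ ∈ A x₁, ∃ y₂ ∈ A x₂, r = ‖y₁ - y₂‖}

/-- The set `S_ε` of points all of whose augmented views have `ε`-close embeddings. -/
def goodSet {N d : ℕ} (A : EuclideanSpace ℝ (Fin N) → Set (EuclideanSpace ℝ (Fin N)))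
    (f : EuclideanSpace ℝ (Fin N) → EuclideanSpace ℝ (Fin d)) (ε : ℝ) :
    Set (EuclideanSpace ℝ (Fin N)) :=
  {x | ∀ y₁ ∈ A x, ∀ y₂ ∈ A x, ‖f y₁ - f y₂‖ ≤ ε}

/-- `(σ,δ)`-augmentation: each class `C k` has a measurable main part `C₀ k ⊆ C k`
with `P[C₀ k] ≥ σ·P[C k]` and augmented diameter at most `δ`. -/
def IsSigmaDeltaAug {N K : ℕ} (P : Measure (EuclideanSpace ℝ (Fin N)))
    (A : EuclideanSpace ℝ (Fin N) → Set (EuclideanSpace ℝ (Fin N)))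
    (C C₀ : Fin K → Set (EuclideanSpace ℝ (Fin N))) (σ δ : ℝ) : Prop :=
  ∀ k, MeasurableSet (C₀ k) ∧ C₀ k ⊆ C k ∧
    σ * (P (C k)).toReal ≤ (P (C₀ k)).toReal ∧
    ∀ x₁ ∈ C₀ k, ∀ x₂ ∈ C₀ k, augDist A x₁ x₂ ≤ δ


/-- The class center `μ = E_{x∈C} E_{x'∈A(x)}[f(x')]`, where the inner expectation
is over the view distribution `ν x` and the outer one is `P` conditioned on `C`. -/
def center {N d : ℕ} (P : Measure (EuclideanSpace ℝ (Fin N)))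
    (ν : EuclideanSpace ℝ (Fin N) → Measure (EuclideanSpace ℝ (Fin N)))
    (C : Set (EuclideanSpace ℝ (Fin N)))
    (f : EuclideanSpace ℝ (Fin N) → EuclideanSpace ℝ (Fin d)) :
    EuclideanSpace ℝ (Fin d) :=
  ⨍ x in C, (∫ y, f y ∂(ν x)) ∂P

/-- The real-number core of the argument, after normalising to `r = 1`. -/
theorem core_real (X Y D B q t σ R ρ s m : ℝ)
    (hq0 : 0 ≤ q) (ht0 : 0 ≤ t) (ht2 : t ≤ 2) (hR : 0 ≤ R)
    (hqσ : σ - R ≤ q) (hσ0 : 0 ≤ σ) (hσ1 : σ ≤ 1)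
    (hρ : 2 * (1 - σ) + R + σ * t ≤ ρ) (hs0 : 0 ≤ s) (hs : s ^ 2 = 2 * ρ)
    (hD0 : 0 ≤ D) (hD : D ≤ 2 * (1 - q) + q * t) (hq1 : q ≤ 1)
    (h2 : q * X - (q * t + (1 - q)) * B ≤ Y) (h3 : X - Y ≤ D * B) (h4 : -1 ≤ Y)
    (h5 : Y < 1 - ρ - s - (1 - m) / 2) (hm : m ≤ B ^ 2) (hB0 : 0 ≤ B) (hB1 : B ≤ 1) :
    X < (1 + B ^ 2 - D ^ 2) / 2 := by
  have hσt : 0 ≤ σ * t := mul_nonneg hσ0 ht0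
  have hρ0 : 0 ≤ ρ := by linarith
  have hRt : 0 ≤ R * t := mul_nonneg hR ht0
  have hE : 2 * (1 - q) + q * t ≤ 2 * ρ := by
    nlinarith [mul_nonneg (sub_nonneg.2 hqσ) (sub_nonneg.2 ht2)]
  have hB2 : B ^ 2 ≤ 1 := by nlinarith
  rcases le_or_gt D s with hDs | hDs
  · have hDB : D * B ≤ D := mul_le_of_le_one_right hD0 hB1
    have hDs2 : D ^ 2 ≤ s ^ 2 := by gcongr
    linarith
  · have hc : 1 / 2 < ρ := by
      by_contra! hc
      have hD2 : D ≤ 2 * ρ := hD.trans hE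
      refine absurd ((pow_le_pow_iff_left₀ hD0 hs0 two_ne_zero).1 ?_) (not_le.2 hDs)
      have : D * D ≤ (2 * ρ) * (2 * ρ) := mul_le_mul hD2 hD2 hD0 (by linarith)
      nlinarith [mul_nonneg hρ0 (sub_nonneg.2 hc)]
    have hs1 : 1 < s := by nlinarith only [hc, hs, hs0]
    have hc' : ρ < 1 := by linarith
    have hs2 : s < 3 / 2 := by nlinarith only [hc', hs, hs0]
    have h7 : 3 / 8 ≤ s - s ^ 2 / 2 := by
      nlinarith only [mul_nonneg (by linarith : 0 ≤ s - 1 / 2) (by linarith : 0 ≤ 3 / 2 - s)]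
    have hEE : 2 * (1 - q) + q * t ≤ ρ + R * (1 - t) := by
      nlinarith only [mul_nonneg (sub_nonneg.2 hqσ) (sub_nonneg.2 ht2), hρ]
    have hRρ : R ≤ ρ - t := by
      nlinarith only [mul_nonneg (sub_nonneg.2 hσ1) (sub_nonneg.2 ht2), hρ]
    have hRlow : 3 / 8 < R * (1 - t) := by linarith
    have ht1 : t < 1 := by
      by_contra! h
      nlinarith only [mul_nonneg hR (sub_nonneg.2 h), hRlow]
    have ht4 : t < 2 / 5 := by
      by_contra! h
      have : R * (1 - t) ≤ (1 - t) * (1 - t) := by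
        apply mul_le_mul_of_nonneg_right <;> linarith
      nlinarith only [this, hRlow, h, ht1]
    have hqt : 0 ≤ q * t := mul_nonneg hq0 ht0
    have hqpos : 0 < q := by
      rcases hq0.eq_or_lt with h | h
      · rw [← h] at hE; linarith
      · exact h
    have hqt4 : q * t ≤ q * (2 / 5) := by gcongr
    have hEdef : ∃ E, E = 2 * (1 - q) + q * t := ⟨_, rfl⟩
    obtain ⟨E, hEdef⟩ := hEdef
    rw [← hEdef] at hD hE hEE
    have hE0 : 0 ≤ E := hD0.trans hD
    have hqE : q ≤ (2 - E) * (5 / 8) := by linarith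
    have hDE : D ^ 2 ≤ E ^ 2 := by gcongr
    have h1 : q * D ^ 2 ≤ (2 - E) * (5 / 8) * E ^ 2 := by
      apply mul_le_mul hqE hDE (by positivity) (by linarith)
    have h6 : (2 - E) * (5 / 8) * E ^ 2 ≤ 20 / 27 := by
      nlinarith only [mul_nonneg (sq_nonneg (E - 4 / 3)) (by linarith : 0 ≤ E + 2 / 3)]
    have h8 : (1 - q) * B ^ 2 ≤ (1 - q) := mul_le_of_le_one_right (by linarith) hB2
    have h9 : (q * t + (1 - q)) * B ≤ (q * t + (1 - q)) :=
      mul_le_of_le_one_right (by linarith) hB1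
    have : q * X < q * ((1 + B ^ 2 - D ^ 2) / 2) := by
      linarith
    exact lt_of_mul_lt_mul_left this hq0

theorem view_close {N d : ℕ} (A : EuclideanSpace ℝ (Fin N) → Set (EuclideanSpace ℝ (Fin N)))
    (hA : ∀ x, x ∈ A x)
    (f : EuclideanSpace ℝ (Fin N) → EuclideanSpace ℝ (Fin d)) (L δ ε : ℝ) (hL : 0 ≤ L)
    (hLip : ∀ x₁ x₂, ‖f x₁ - f x₂‖ ≤ L * ‖x₁ - x₂‖)
    (x z : EuclideanSpace ℝ (Fin N)) (hx : x ∈ goodSet A f ε) (hz : z ∈ goodSet A f ε)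
    (hd : augDist A x z ≤ δ) (y : EuclideanSpace ℝ (Fin N)) (hy : y ∈ A z) :
    ‖f x - f y‖ ≤ L * δ + 2 * ε := by
  refine le_of_forall_pos_le_add fun η hη => ?_
  have hη' : 0 < η / (L + 1) := by positivity
  have hlt : augDist A x z < δ + η / (L + 1) := by linarith
  obtain ⟨w, ⟨y₁, hy₁, y₂, hy₂, rfl⟩, hw⟩ :=
    exists_lt_of_csInf_lt (by exact ⟨_, x, hA x, z, hA z, rfl⟩) hlt
  have h1 := hx x (hA x) y₁ hy₁
  have h2 := hz y₂ hy₂ y hy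
  have h3 := hLip y₁ y₂
  have h4 : L * ‖y₁ - y₂‖ ≤ L * (δ + η / (L + 1)) := by gcongr
  have h5 : L * (η / (L + 1)) ≤ η := by
    rw [mul_div_assoc', div_le_iff₀ (by positivity)]; nlinarith
  have h6 : f x - f y = (f x - f y₁) + (f y₁ - f y₂) + (f y₂ - f y) := by abel
  rw [h6]
  have := norm_add₃_le (a := f x - f y₁) (b := f y₁ - f y₂) (c := f y₂ - f y)
  nlinarith

theorem center_bounds {N d : ℕ} (P : Measure (EuclideanSpace ℝ (Fin N))) [IsProbabilityMeasure P]
    (g : EuclideanSpace ℝ (Fin N) → EuclideanSpace ℝ (Fin d)) (hg : Integrable g P)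
    (C M : Set (EuclideanSpace ℝ (Fin N))) (hC : MeasurableSet C) (hM : MeasurableSet M)
    (hMC : M ⊆ C) (hp : 0 < P.real C) (c : EuclideanSpace ℝ (Fin d)) (a b : ℝ)
    (h1 : ∀ x ∈ M, ‖g x - c‖ ≤ a) (h2 : ∀ x, ‖g x - c‖ ≤ b) :
    ‖(⨍ x in C, g x ∂P) - c‖ ≤ (P.real M / P.real C) * a + (1 - P.real M / P.real C) * b := by
  have hi : Integrable (fun x => g x - c) P := hg.sub (integrable_const c)
  have e1 : ∫ x in C, (g x - c) ∂P = ∫ x in M, (g x - c) ∂P + ∫ x in C \ M, (g x - c) ∂P := by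
    rw [← setIntegral_union Set.disjoint_sdiff_right (hC.diff hM) hi.integrableOn hi.integrableOn,
      Set.union_sdiff_cancel hMC]
  have e2 : ∫ x in C, (g x - c) ∂P = P.real C • ((⨍ x in C, g x ∂P) - c) := by
    rw [integral_sub hg.integrableOn (integrable_const c), setAverage_eq, smul_sub, smul_smul,
      mul_inv_cancel₀ hp.ne', one_smul, setIntegral_const]
  have e3 : P.real (C \ M) = P.real C - P.real M := measureReal_sdiff hMC hM
  have n1 : ‖∫ x in M, (g x - c) ∂P‖ ≤ a * P.real M :=
    norm_setIntegral_le_of_norm_le_const (measure_lt_top _ _) h1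
  have n2 : ‖∫ x in C \ M, (g x - c) ∂P‖ ≤ b * P.real (C \ M) :=
    norm_setIntegral_le_of_norm_le_const (measure_lt_top _ _) (fun x _ => h2 x)
  have n3 := norm_add_le (∫ x in M, (g x - c) ∂P) (∫ x in C \ M, (g x - c) ∂P)
  rw [← e1, e2, norm_smul, Real.norm_of_nonneg hp.le] at n3
  rw [e3] at n2
  refine le_of_mul_le_mul_left ?_ hp
  have : P.real C * (P.real M / P.real C * a + (1 - P.real M / P.real C) * b)
    = a * P.real M + b * (P.real C - P.real M) := by field_simp
  rw [this]; linarith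

/-- The bound on `μ - q e`. -/
theorem center_bounds' {N d : ℕ} (P : Measure (EuclideanSpace ℝ (Fin N))) [IsProbabilityMeasure P]
    (g : EuclideanSpace ℝ (Fin N) → EuclideanSpace ℝ (Fin d)) (hg : Integrable g P)
    (C M : Set (EuclideanSpace ℝ (Fin N))) (hC : MeasurableSet C) (hM : MeasurableSet M)
    (hMC : M ⊆ C) (hp : 0 < P.real C) (c : EuclideanSpace ℝ (Fin d)) (a b : ℝ)
    (h1 : ∀ x ∈ M, ‖g x - c‖ ≤ a) (h2 : ∀ x, ‖g x‖ ≤ b) :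
    ‖(⨍ x in C, g x ∂P) - (P.real M / P.real C) • c‖
      ≤ (P.real M / P.real C) * a + (1 - P.real M / P.real C) * b := by
  have e1 : ∫ x in C, g x ∂P = ∫ x in M, g x ∂P + ∫ x in C \ M, g x ∂P := by
    rw [← setIntegral_union Set.disjoint_sdiff_right (hC.diff hM) hg.integrableOn hg.integrableOn,
      Set.union_sdiff_cancel hMC]
  have e0 : ∫ x in M, (g x - c) ∂P = ∫ x in M, g x ∂P - P.real M • c := by
    rw [integral_sub hg.integrableOn (integrable_const c), setIntegral_const]
  have e2 : P.real C • ((⨍ x in C, g x ∂P) - (P.real M / P.real C) • c)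
      = ∫ x in M, (g x - c) ∂P + ∫ x in C \ M, g x ∂P := by
    rw [e0, setAverage_eq, smul_sub, smul_smul, smul_smul, mul_div_cancel₀ _ hp.ne',
      mul_inv_cancel₀ hp.ne', one_smul, e1]
    abel
  have e3 : P.real (C \ M) = P.real C - P.real M := measureReal_sdiff hMC hM
  have n1 : ‖∫ x in M, (g x - c) ∂P‖ ≤ a * P.real M :=
    norm_setIntegral_le_of_norm_le_const (measure_lt_top _ _) h1
  have n2 : ‖∫ x in C \ M, g x ∂P‖ ≤ b * P.real (C \ M) :=
    norm_setIntegral_le_of_norm_le_const (measure_lt_top _ _) (fun x _ => h2 x)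
  have n3 := norm_add_le (∫ x in M, (g x - c) ∂P) (∫ x in C \ M, g x ∂P)
  rw [← e2, norm_smul, Real.norm_of_nonneg hp.le] at n3
  rw [e3] at n2
  refine le_of_mul_le_mul_left ?_ hp
  have : P.real C * (P.real M / P.real C * a + (1 - P.real M / P.real C) * b)
    = a * P.real M + b * (P.real C - P.real M) := by field_simp
  rw [this]; linarith

/-- Lemma 3.2: under the divergence condition on `μ_ℓᵀμ_k`,
every `x ∈ C_ℓ⁰ ∩ S_ε` is correctly classified by the NN classifier. -/
theorem stmt_3 {N d K : ℕ} (hK : 0 < K)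
    (P : Measure (EuclideanSpace ℝ (Fin N))) [IsProbabilityMeasure P]
    (A : EuclideanSpace ℝ (Fin N) → Set (EuclideanSpace ℝ (Fin N)))
    (hA : ∀ x, x ∈ A x)
    (ν : EuclideanSpace ℝ (Fin N) → Measure (EuclideanSpace ℝ (Fin N)))
    (hν : ∀ x, IsProbabilityMeasure (ν x))
    (hνsupp : ∀ x, (ν x) ((A x)ᶜ) = 0)
    (C C₀ : Fin K → Set (EuclideanSpace ℝ (Fin N)))
    (hCmeas : ∀ k, MeasurableSet (C k))
    (hCdisj : ∀ k l, k ≠ l → Disjoint (C k) (C l))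
    (hCtot : ∑ k, (P (C k)).toReal = 1)
    (hp : ∀ k, 0 < (P (C k)).toReal)
    (f : EuclideanSpace ℝ (Fin N) → EuclideanSpace ℝ (Fin d))
    (hfm : Measurable f)
    (hgint : Integrable (fun x => ∫ y, f y ∂(ν x)) P)
    (r L : ℝ) (hr : 0 < r) (hL : 0 ≤ L)
    (hnorm : ∀ x, ‖f x‖ = r)
    (hLip : ∀ x₁ x₂, ‖f x₁ - f x₂‖ ≤ L * ‖x₁ - x₂‖)
    (σ δ ε : ℝ) (hσ : 0 < σ) (hσ1 : σ ≤ 1) (hδ : 0 ≤ δ) (hε : 0 < ε)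
    (haug : IsSigmaDeltaAug P A C C₀ σ δ)
    (ℓ : Fin K)
    (hdiv : ∀ k : Fin K, k ≠ ℓ →
      (inner ℝ (center P ν (C ℓ) f) (center P ν (C k) f) : ℝ)
        < r ^ 2 * (1
            - (2 * (1 - σ) + (P ((goodSet A f ε)ᶜ)).toReal / (P (C ℓ)).toReal
                + σ * (L * δ / r + 2 * ε / r))
            - Real.sqrt (2 * (2 * (1 - σ)
                + (P ((goodSet A f ε)ᶜ)).toReal / (P (C ℓ)).toReal
                + σ * (L * δ / r + 2 * ε / r)))
            - (1 - (⨅ k : Fin K, ‖center P ν (C k) f‖ ^ 2) / r ^ 2) / 2)) :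
    ∀ x ∈ C₀ ℓ ∩ goodSet A f ε, ∀ k : Fin K, k ≠ ℓ →
      ‖f x - center P ν (C ℓ) f‖ < ‖f x - center P ν (C k) f‖ := by
  rintro x ⟨hx0, hxS⟩ k hk
  have hdk := hdiv k hk
  obtain ⟨hM0, hC0C, hσp, hdist⟩ := haug ℓ
  set g : EuclideanSpace ℝ (Fin N) → EuclideanSpace ℝ (Fin d) := fun x => ∫ y, f y ∂(ν x) with hgdef
  have hgr : ∀ z, ‖g z‖ ≤ r := fun z => by
    have := hν z
    have := norm_integral_le_of_norm_le_const (μ := ν z) (f := f) (C := r)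
      (Filter.Eventually.of_forall fun y => (hnorm y).le)
    simpa using this
  have hfint : ∀ z, Integrable f (ν z) := fun z => by
    have := hν z
    exact Integrable.of_bound hfm.aestronglyMeasurable r
      (Filter.Eventually.of_forall fun y => (hnorm y).le)
  set T := toMeasurable P ((goodSet A f ε)ᶜ) with hT
  have hTm : MeasurableSet T := measurableSet_toMeasurable _ _
  set M := C₀ ℓ \ T with hMdef
  have hM : MeasurableSet M := hM0.diff hTm
  have hMC : M ⊆ C ℓ := Set.sdiff_subset.trans hC0C
  set τ := min (L * δ + 2 * ε) (2 * r) with hτ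
  have hτ0 : 0 ≤ τ := le_min (by positivity) (by positivity)
  have hall : ∀ z, ‖g z - f x‖ ≤ 2 * r := fun z => by
    have := norm_sub_le (g z) (f x)
    have := hgr z
    have := hnorm x
    linarith
  have hgood : ∀ z ∈ M, ‖g z - f x‖ ≤ τ := fun z hz => by
    refine le_min ?_ (hall z)
    have hzS : z ∈ goodSet A f ε := by
      by_contra h
      exact hz.2 (subset_toMeasurable _ _ h)
    have := hν z
    have e : g z - f x = ∫ y, (f y - f x) ∂(ν z) := by
      rw [integral_sub (hfint z) (integrable_const _)]; simp [hgdef]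
    have hae : ∀ᵐ y ∂(ν z), ‖f y - f x‖ ≤ L * δ + 2 * ε := by
      have hA' : ∀ᵐ y ∂(ν z), y ∈ A z := by
        rw [ae_iff]; exact hνsupp z
      filter_upwards [hA'] with y hy
      rw [norm_sub_rev]
      exact view_close A hA f L δ ε hL hLip x z hxS hzS (hdist x hx0 z hz.1) y hy
    rw [e]
    simpa using norm_integral_le_of_norm_le_const hae
  have hpl : 0 < P.real (C ℓ) := hp ℓ
  have hctr : ∀ j, ‖center P ν (C j) f‖ ≤ r := fun j => by
    have := center_bounds' P g hgint (C j) ∅ (hCmeas j) MeasurableSet.empty (by simp) (hp j)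
      0 0 r (by simp) hgr
    simpa [center] using this
  have hb1 := center_bounds P g hgint (C ℓ) M (hCmeas ℓ) hM hMC hpl (f x) τ (2 * r) hgood hall
  have hb2 := center_bounds' P g hgint (C ℓ) M (hCmeas ℓ) hM hMC hpl (f x) τ r hgood hgr
  change ‖center P ν (C ℓ) f - f x‖ ≤ _ at hb1
  change ‖center P ν (C ℓ) f - _‖ ≤ _ at hb2
  have hmul := hctr ℓ
  have hmuk := hctr k
  have hinf : (⨅ k : Fin K, ‖center P ν (C k) f‖ ^ 2) ≤ ‖center P ν (C k) f‖ ^ 2 :=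
    ciInf_le (Set.finite_range _).bddBelow k
  have hMT : P.real (C₀ ℓ) ≤ P.real M + P.real T := by
    refine (measureReal_mono (fun z hz => ?_ : C₀ ℓ ⊆ M ∪ T)).trans (measureReal_union_le _ _)
    by_cases h : z ∈ T
    · exact Or.inr h
    · exact Or.inl ⟨hz, h⟩
  have hTR : P.real T = (P ((goodSet A f ε)ᶜ)).toReal := by
    rw [hT, measureReal_def, measure_toMeasurable]
  rw [hTR] at hMT
  have hσp' : σ * P.real (C ℓ) ≤ P.real (C₀ ℓ) := hσp
  have hpk : (P (C ℓ)).toReal = P.real (C ℓ) := rfl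
  rw [hpk] at hdk
  have hR0 : 0 ≤ (P ((goodSet A f ε)ᶜ)).toReal := ENNReal.toReal_nonneg
  have hMp : P.real M ≤ P.real (C ℓ) := measureReal_mono hMC
  have hM00 : 0 ≤ P.real M := measureReal_nonneg
  generalize (P ((goodSet A f ε)ᶜ)).toReal = R at *
  generalize (⨅ k : Fin K, ‖center P ν (C k) f‖ ^ 2) = m at *
  have hnx := hnorm x
  generalize center P ν (C ℓ) f = μ at *
  generalize center P ν (C k) f = b at *
  generalize f x = e at *
  generalize P.real (C ℓ) = p at *
  generalize hqq : P.real M / p = q at *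
  have hq0 : 0 ≤ q := by rw [← hqq]; positivity
  have hq1 : q ≤ 1 := by rw [← hqq, div_le_one hpl]; exact hMp
  have hqσ : σ - R / p ≤ q := by
    rw [← hqq, sub_le_iff_le_add, ← add_div, le_div_iff₀ hpl]; linarith
  generalize hρd : 2 * (1 - σ) + R / p + σ * (L * δ / r + 2 * ε / r) = ρ at *
  have hτr : τ / r ≤ L * δ / r + 2 * ε / r := by
    rw [← add_div]; gcongr; exact min_le_left _ _
  have hRp : 0 ≤ R / p := by positivity
  have hρ0 : 0 ≤ ρ := by
    rw [← hρd]
    have : 0 ≤ σ * (L * δ / r + 2 * ε / r) := by positivity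
    linarith
  have hr2 : 0 < r ^ 2 := by positivity
  have key := core_real (inner ℝ e b / r ^ 2) (inner ℝ μ b / r ^ 2) (‖μ - e‖ / r) (‖b‖ / r)
    q (τ / r) σ (R / p) ρ (Real.sqrt (2 * ρ)) (m / r ^ 2) hq0 (by positivity)
    (by rw [div_le_iff₀ hr]; exact min_le_right _ _) hRp hqσ hσ.le hσ1
    (by rw [← hρd]; gcongr) (Real.sqrt_nonneg _) (Real.sq_sqrt (by positivity))
    (by positivity)
    (by
      rw [div_le_iff₀ hr]
      have : (2 * (1 - q) + q * (τ / r)) * r = q * τ + (1 - q) * (2 * r) := by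
        field_simp; ring
      rw [this]; exact hb1) hq1
    (by
      have h := real_inner_le_norm (q • e - μ) b
      rw [norm_sub_rev, inner_sub_left, real_inner_smul_left] at h
      have h' := mul_le_mul_of_nonneg_right hb2 (norm_nonneg b)
      rw [le_div_iff₀ hr2]
      have : (q * (inner ℝ e b / r ^ 2) - (q * (τ / r) + (1 - q)) * (‖b‖ / r)) * r ^ 2
        = q * inner ℝ e b - (q * τ + (1 - q) * r) * ‖b‖ := by
        field_simp
      rw [this]; linarith)
    (by
      have h := real_inner_le_norm (e - μ) b
      rw [norm_sub_rev, inner_sub_left] at h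
      rw [← sub_div, div_mul_div_comm, ← pow_two]
      gcongr)
    (by
      have h := (abs_le.1 (abs_real_inner_le_norm μ b)).1
      have h' : ‖μ‖ * ‖b‖ ≤ r * r := by gcongr
      rw [le_div_iff₀ hr2]; nlinarith)
    (by rw [div_lt_iff₀ hr2, mul_comm]; exact hdk)
    (by rw [div_pow]; gcongr) (by positivity) (by rw [div_le_one hr]; exact hmuk)
  have hfin : inner ℝ e b < (r ^ 2 + ‖b‖ ^ 2 - ‖μ - e‖ ^ 2) / 2 := by
    rw [div_lt_iff₀ hr2] at key
    have h : (1 + (‖b‖ / r) ^ 2 - (‖μ - e‖ / r) ^ 2) / 2 * r ^ 2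
        = (r ^ 2 + ‖b‖ ^ 2 - ‖μ - e‖ ^ 2) / 2 := by
      field_simp
    rwa [h] at key
  have hexp := norm_sub_sq_real e b
  rw [hnx] at hexp
  rw [norm_sub_rev e μ]
  refine lt_of_pow_lt_pow_left₀ 2 (norm_nonneg _) ?_
  linarith
end
end

section
/- If the encoder f : ℝ^N → ℝ^d satisfies the per-coordinate normalization E_x E_{x_1∈A(x)}[f_i(x_1)²] = 1 for each i ∈ [d], then the alignment loss is bounded by the diagonal cross-correlation loss: L_pos(f) := E_x E_{x_1,x_2∈A(x)}‖f(x_1)−f(x_2)‖² ≤ 2·√(d·L_1(f)), where L_1(f) = Σ_{i=1}^d (1 − E_x E_{x_1,x_2∈A(x)}[f_i(x_1)f_i(x_2)])². -/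
open MeasureTheory

noncomputable section

theorem aux_inner {Ω : Type*} [MeasurableSpace Ω] {d : ℕ} (μ : Measure Ω) [IsProbabilityMeasure μ]
    (f : Ω → EuclideanSpace ℝ (Fin d)) (h : MemLp f 2 μ) :
    ∫ y₁, ∫ y₂, ‖f y₁ - f y₂‖ ^ 2 ∂μ ∂μ
      = 2 * ∑ i, ∫ y, (f y i) ^ 2 ∂μ - 2 * ∑ i, (∫ y, f y i ∂μ) ^ 2 := by
  have hc : ∀ i, MemLp (fun y => f y i) 2 μ := fun i =>
    MemLp.of_le h ((EuclideanSpace.proj (𝕜 := ℝ) i).continuous.comp_aestronglyMeasurable h.1)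
      (Filter.Eventually.of_forall fun y => PiLp.norm_apply_le (f y) i)
  have h1 : ∀ i, Integrable (fun y => f y i) μ := fun i => (hc i).integrable one_le_two
  have h2 : ∀ i, Integrable (fun y => (f y i) ^ 2) μ := fun i => (hc i).integrable_sq
  have e1 : ∀ y₁, ∫ y₂, ‖f y₁ - f y₂‖ ^ 2 ∂μ
      = ∑ i, ((f y₁ i) ^ 2 - 2 * (∫ y, f y i ∂μ) * f y₁ i + ∫ y, (f y i) ^ 2 ∂μ) := by
    intro y₁
    have : ∀ y₂, ‖f y₁ - f y₂‖ ^ 2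
        = ∑ i, ((f y₁ i) ^ 2 - 2 * f y₁ i * f y₂ i + (f y₂ i) ^ 2) := by
      intro y₂
      rw [EuclideanSpace.real_norm_sq_eq]
      refine Finset.sum_congr rfl fun i _ => ?_
      simp only [PiLp.sub_apply]; ring
    simp_rw [this]
    have ha : ∀ i, Integrable (fun y₂ => (f y₁ i) ^ 2 - 2 * f y₁ i * f y₂ i) μ := fun i =>
      (integrable_const _).sub ((h1 i).const_mul _)
    have hb : ∀ i, Integrable
        (fun y₂ => (f y₁ i) ^ 2 - 2 * f y₁ i * f y₂ i + (f y₂ i) ^ 2) μ :=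
      fun i => (ha i).add (h2 i)
    rw [integral_finsetSum _ fun i _ => hb i]
    refine Finset.sum_congr rfl fun i _ => ?_
    rw [integral_add (ha i) (h2 i), integral_sub (integrable_const _) ((h1 i).const_mul _),
      integral_const_mul]
    simp; ring
  simp_rw [e1]
  have ha : ∀ i, Integrable (fun y₁ => (f y₁ i) ^ 2 - 2 * (∫ y, f y i ∂μ) * f y₁ i) μ := fun i =>
      (h2 i).sub ((h1 i).const_mul _)
  have hb : ∀ i, Integrable (fun y₁ => (f y₁ i) ^ 2 - 2 * (∫ y, f y i ∂μ) * f y₁ i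
      + ∫ y, (f y i) ^ 2 ∂μ) μ := fun i => (ha i).add (integrable_const _)
  rw [integral_finsetSum _ fun i _ => hb i, Finset.mul_sum,
    Finset.mul_sum, ← Finset.sum_sub_distrib]
  refine Finset.sum_congr rfl fun i _ => ?_
  rw [integral_add (ha i) (integrable_const _), integral_sub (h2 i) ((h1 i).const_mul _),
      integral_const_mul]
  simp; ring

/-- Lemma 4.2: under per-coordinate normalization,
`L_pos(f) = E_x E_{x₁,x₂∈A(x)}‖f(x₁)−f(x₂)‖² ≤ 2√(d·L₁(f))`, where
`L₁(f) = Σᵢ (1 − E_x E[fᵢ(x₁)fᵢ(x₂)])²`. -/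
theorem stmt_12 {N d : ℕ}
    (P : Measure (EuclideanSpace ℝ (Fin N))) [IsProbabilityMeasure P]
    (A : EuclideanSpace ℝ (Fin N) → Set (EuclideanSpace ℝ (Fin N)))
    (hA : ∀ x, x ∈ A x)
    (ν : EuclideanSpace ℝ (Fin N) → Measure (EuclideanSpace ℝ (Fin N)))
    (hν : ∀ x, IsProbabilityMeasure (ν x))
    (hνsupp : ∀ x, (ν x) ((A x)ᶜ) = 0)
    (f : EuclideanSpace ℝ (Fin N) → EuclideanSpace ℝ (Fin d))
    (hfm : Measurable f)
    (hf2 : ∀ x, MemLp f 2 (ν x))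
    (hfint : Integrable (fun x => ∫ y, ‖f y‖ ^ 2 ∂(ν x)) P)
    (hnormalized : ∀ i : Fin d, ∫ x, ∫ y, (f y i) ^ 2 ∂(ν x) ∂P = 1) :
    ∫ x, ∫ y₁, ∫ y₂, ‖f y₁ - f y₂‖ ^ 2 ∂(ν x) ∂(ν x) ∂P
      ≤ 2 * Real.sqrt ((d : ℝ) * ∑ i : Fin d,
          (1 - ∫ x, ∫ y₁, ∫ y₂, (f y₁ i) * (f y₂ i) ∂(ν x) ∂(ν x) ∂P) ^ 2) := by
  have hin : ∀ x, _ := fun x => haveI := hν x; aux_inner (ν x) f (hf2 x)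
  simp_rw [hin]
  have hm : ∀ x, ∀ i : Fin d, ∫ y₁, ∫ y₂, (f y₁ i) * (f y₂ i) ∂(ν x) ∂(ν x)
      = (∫ y, f y i ∂(ν x)) ^ 2 := by
    intro x i
    simp_rw [integral_const_mul, integral_mul_const]; ring
  simp_rw [hm]
  have hS : ∀ i : Fin d, Integrable (fun x => ∫ y, (f y i) ^ 2 ∂(ν x)) P := by
    intro i
    by_contra hc
    have := hnormalized i
    rw [integral_undef hc] at this
    exact zero_ne_one this
  have hSS : Integrable (fun x => 2 * ∑ i, ∫ y, (f y i) ^ 2 ∂(ν x)) P :=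
    (integrable_finsetSum _ fun i _ => hS i).const_mul 2
  set m : Fin d → EuclideanSpace ℝ (Fin N) → ℝ := fun i x => (∫ y, f y i ∂(ν x)) ^ 2 with hmdef
  have key : ∫ x, (2 * ∑ i, ∫ y, (f y i) ^ 2 ∂(ν x) - 2 * ∑ i, m i x) ∂P
      ≤ 2 * Real.sqrt ((d : ℝ) * ∑ i, (1 - ∫ x, m i x ∂P) ^ 2) := by
    by_cases hI : Integrable (fun x => 2 * ∑ i, ∫ y, (f y i) ^ 2 ∂(ν x) - 2 * ∑ i, m i x) P
    swap
    · rw [integral_undef hI]; positivity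
    have hM : Integrable (fun x => ∑ i, m i x) P := by
      have := (hSS.sub hI).const_mul (1 / 2)
      refine this.congr (Filter.Eventually.of_forall fun x => ?_)
      simp only [Pi.sub_apply]; ring
    rw [integral_sub hSS (hM.const_mul 2), integral_const_mul, integral_const_mul,
      integral_finsetSum _ fun i _ => hS i]
    simp_rw [hnormalized]
    have hle : ∑ i, ∫ x, m i x ∂P ≤ ∫ x, ∑ i, m i x ∂P := by
      classical
      let g : Fin d → EuclideanSpace ℝ (Fin N) → ℝ := fun i => if Integrable (m i) P then m i else 0
      have hg : ∀ i, Integrable (g i) P := by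
        intro i
        by_cases h : Integrable (m i) P
        · simpa [g, h] using h
        · simp only [g, h, if_false]; exact integrable_zero _ _ _
      have hgi : ∀ i, ∫ x, m i x ∂P = ∫ x, g i x ∂P := by
        intro i
        by_cases h : Integrable (m i) P
        · simp [g, h]
        · rw [integral_undef h]; simp [g, h]
      simp_rw [hgi]
      rw [← integral_finsetSum _ fun i _ => hg i]
      refine integral_mono (integrable_finsetSum _ fun i _ => hg i) hM fun x => ?_
      refine Finset.sum_le_sum fun i _ => ?_
      by_cases h : Integrable (m i) P
      · simp [g, h]
      · simp only [g, h, if_false]; exact sq_nonneg _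
    have hcs : ∑ i, (1 - ∫ x, m i x ∂P)
        ≤ Real.sqrt ((d : ℝ) * ∑ i, (1 - ∫ x, m i x ∂P) ^ 2) := by
      apply Real.le_sqrt_of_sq_le
      simpa using sq_sum_le_card_mul_sum_sq (s := Finset.univ)
        (f := fun i : Fin d => 1 - ∫ x, m i x ∂P)
    rw [Finset.sum_sub_distrib] at hcs
    linarith
  exact key
end
end

section
/- Let μ_1,…,μ_K ∈ ℝ^d and let p_1,…,p_K ≥ 0. Then for any pair of indices k ≠ ℓ: ‖Σ_{j=1}^K p_j·μ_jμ_jᵀ − I_d‖_F² ≥ p_k·p_ℓ·(μ_kᵀμ_ℓ)² + d − K. -/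
theorem aux_expand {d K : ℕ} (x : Fin K → Fin d → ℝ) (p : Fin K → ℝ) :
    ∑ i : Fin d, ∑ j : Fin d,
          ((∑ m : Fin K, p m * (x m i) * (x m j)) - (if i = j then 1 else 0)) ^ 2
    = ∑ m : Fin K, ∑ n : Fin K, p m * p n * (∑ i, x m i * x n i) ^ 2
      - 2 * ∑ m : Fin K, p m * (∑ i, x m i * x m i) + d := by
  have h1 : ∀ i j : Fin d,
      ((∑ m : Fin K, p m * (x m i) * (x m j)) - (if i = j then 1 else 0)) ^ 2
      = (∑ m : Fin K, p m * (x m i) * (x m j)) ^ 2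
        - (if i = j then 2 * (∑ m : Fin K, p m * (x m i) * (x m j)) - 1 else 0) := by
    intro i j
    split_ifs <;> ring
  simp only [h1, Finset.sum_sub_distrib, Finset.sum_ite_eq, Finset.mem_univ, if_true]
  have h2 : ∑ i : Fin d, ∑ j : Fin d, (∑ m : Fin K, p m * (x m i) * (x m j)) ^ 2
      = ∑ m : Fin K, ∑ n : Fin K, p m * p n * (∑ i, x m i * x n i) ^ 2 := by
    simp only [sq, Finset.sum_mul_sum]
    simp only [Finset.mul_sum]
    rw [Finset.sum_congr rfl (fun i _ => Finset.sum_comm), Finset.sum_comm]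
    refine Finset.sum_congr rfl fun m _ => ?_
    rw [Finset.sum_congr rfl (fun i _ => Finset.sum_comm), Finset.sum_comm]
    refine Finset.sum_congr rfl fun n _ => ?_
    refine Finset.sum_congr rfl fun i _ => Finset.sum_congr rfl fun j _ => ?_
    ring
  have h3 : ∑ i : Fin d, 2 * ∑ m : Fin K, p m * x m i * x m i
      = 2 * ∑ m : Fin K, p m * (∑ i, x m i * x m i) := by
    rw [← Finset.mul_sum, Finset.sum_comm]
    simp only [Finset.mul_sum, mul_assoc]
  rw [h2, h3]
  simp
  ring

/-- for `μ_1,…,μ_K ∈ ℝ^d`, `p_1,…,p_K ≥ 0` and `k ≠ ℓ`,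
`‖Σ_j p_j μ_j μ_jᵀ − I_d‖_F² ≥ p_k p_ℓ (μ_kᵀμ_ℓ)² + d − K`. -/
theorem stmt_17 {d K : ℕ} (μ : Fin K → EuclideanSpace ℝ (Fin d))
    (p : Fin K → ℝ) (hp : ∀ j, 0 ≤ p j)
    (k ℓ : Fin K) (hkl : k ≠ ℓ) :
    p k * p ℓ * ((inner ℝ (μ k) (μ ℓ) : ℝ)) ^ 2 + (d : ℝ) - (K : ℝ)
      ≤ ∑ i : Fin d, ∑ j : Fin d,
          ((∑ m : Fin K, p m * (μ m i) * (μ m j)) - (if i = j then 1 else 0)) ^ 2 := by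
  have hin : (inner ℝ (μ k) (μ ℓ) : ℝ) = ∑ i, μ k i * μ ℓ i := by
    simp [PiLp.inner_apply, mul_comm]
  rw [aux_expand (fun m i => μ m i) p, hin]
  set G : Fin K → Fin K → ℝ := fun m n => ∑ i, μ m i * μ n i with hG
  let f : Fin K → Fin K → ℝ := fun m n =>
    p m * p n * (G m n) ^ 2 - (if m = n then 2 * (p m * G m m) - 1 else 0)
  have hf : ∀ m n, 0 ≤ f m n := by
    intro m n
    by_cases h : m = n
    · subst h
      simp only [f, if_true]
      nlinarith [sq_nonneg (p m * G m m - 1)]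
    · simp only [f, h, if_false, sub_zero]
      exact mul_nonneg (mul_nonneg (hp m) (hp n)) (sq_nonneg _)
  have h1 : f k ℓ ≤ ∑ m, ∑ n, f m n :=
    (Finset.single_le_sum (f := fun n => f k n) (fun n _ => hf k n) (Finset.mem_univ ℓ)).trans
      (Finset.single_le_sum (f := fun m => ∑ n, f m n)
        (fun m _ => Finset.sum_nonneg fun n _ => hf m n) (Finset.mem_univ k))
  have h2 : ∑ m, ∑ n, f m n
      = ∑ m, ∑ n, p m * p n * (G m n) ^ 2 - 2 * ∑ m, p m * G m m + K := by
    simp only [f, Finset.sum_sub_distrib, Finset.sum_ite_eq, Finset.mem_univ, if_true,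
      ← Finset.mul_sum]
    simp
    ring
  have h3 : f k ℓ = p k * p ℓ * (G k ℓ) ^ 2 := by simp [f, hkl]
  change p k * p ℓ * (G k ℓ) ^ 2 + (d : ℝ) - K ≤
    ∑ m, ∑ n, p m * p n * (G m n) ^ 2 - 2 * ∑ m, p m * G m m + d
  linarith
end

section
/- Suppose the encoder f is L-Lipschitz with ‖f(x)‖ = √d for all x, and the augmentation is a (σ,δ)-augmentation. Then for every ε>0 and every pair k ≠ ℓ: (μ_kᵀμ_ℓ)² ≤ (2/(p_k·p_ℓ))·(L_2(f) + τ'(ε,σ,δ) − (d−K)/2), where L_2(f) = ‖E_x E_{x_1,x_2∈A(x)}[f(x_1)f(x_2)ᵀ] − I_d‖_F² and τ'(ε,σ,δ) = 4d·(1−σ+(2ε+Lδ)/(2√d))² + 4(1−σ)d + 8dK·R_ε·(3/2−σ+(2ε+Lδ)/(2√d)) + 4d·R_ε²·Σ_{k=1}^K (1/p_k) + √2·d^{3/4}·L_1(f)^{1/4}, with L_1(f) = Σ_{i=1}^d (1 − E_x E_{x_1,x_2∈A(x)}[f_i(x_1)f_i(x_2)])². -/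
open MeasureTheory

noncomputable section

lemma aux_alg {d K : ℕ} (G : Fin d → Fin d → ℝ) (p : Fin K → ℝ) (hp : ∀ k, 0 ≤ p k)
    (m : Fin K → Fin d → ℝ) (D : Fin K → Fin K → ℝ) (hD : ∀ k l, D k l = ∑ i, m k i * m l i)
    (hG : ∀ l, ∑ k, p k * (D k l) ^ 2 ≤ ∑ i, ∑ j, G i j * (m l i * m l j))
    (V : ℝ) (hV : ∑ i, G i i - ∑ k, p k * D k k ≤ V) (k l : Fin K) (hkl : k ≠ l) :
    2 * (p k * p l * (D k l) ^ 2) ≤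
      ∑ i, ∑ j, (G i j - (if i = j then 1 else 0)) ^ 2 + 2 * V - ((d : ℝ) - K) := by
  classical
  set Q : ℝ := ∑ l, ∑ k, p l * (p k * (D k l) ^ 2) with hQ
  have h1 : ∑ i, ∑ j, (G i j - (if i = j then 1 else 0)) ^ 2
      = ∑ i, ∑ j, (G i j) ^ 2 - 2 * ∑ i, G i i + d := by
    have : ∀ i j : Fin d, (G i j - (if i = j then 1 else 0)) ^ 2
        = (G i j) ^ 2 - 2 * (if i = j then G i j else 0) + (if i = j then 1 else 0) := by
      intro i j; split_ifs <;> ring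
    simp only [this, Finset.sum_add_distrib, Finset.sum_sub_distrib, ← Finset.mul_sum]
    simp
  set M : Fin d → Fin d → ℝ := fun i j => ∑ k, p k * (m k i * m k j) with hM
  have hGM : ∑ i, ∑ j, G i j * M i j = ∑ l, p l * ∑ i, ∑ j, G i j * (m l i * m l j) := by
    simp only [hM, Finset.mul_sum]
    rw [Finset.sum_congr rfl (fun i _ => Finset.sum_comm), Finset.sum_comm]
    refine Finset.sum_congr rfl fun l _ => Finset.sum_congr rfl fun i _ =>
      Finset.sum_congr rfl fun j _ => by ring
  have hMm : ∀ l, ∑ i, ∑ j, M i j * (m l i * m l j) = ∑ k, p k * (D k l) ^ 2 := by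
    intro l
    simp only [hM, Finset.sum_mul]
    rw [Finset.sum_congr rfl (fun i _ => Finset.sum_comm), Finset.sum_comm]
    refine Finset.sum_congr rfl fun k _ => ?_
    rw [hD, sq, Finset.sum_mul_sum, Finset.mul_sum]
    refine Finset.sum_congr rfl fun i _ => ?_
    rw [Finset.mul_sum]
    refine Finset.sum_congr rfl fun j _ => by ring
  have hMM : ∑ i, ∑ j, M i j * M i j = Q := by
    have : ∑ i, ∑ j, M i j * M i j = ∑ l, p l * ∑ i, ∑ j, M i j * (m l i * m l j) := by
      conv_lhs => 
        enter [2, i, 2, j]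
        rw [show M i j * M i j = ∑ l, M i j * (p l * (m l i * m l j)) by
          rw [← Finset.mul_sum]]
      simp only [Finset.mul_sum]
      rw [Finset.sum_congr rfl (fun i _ => Finset.sum_comm), Finset.sum_comm]
      refine Finset.sum_congr rfl fun l _ => Finset.sum_congr rfl fun i _ =>
        Finset.sum_congr rfl fun j _ => by ring
    rw [this, hQ]
    simp only [hMm, Finset.mul_sum]
  have h2 : Q ≤ ∑ i, ∑ j, G i j * M i j := by
    rw [hGM, hQ]
    refine Finset.sum_le_sum fun l _ => ?_
    rw [← Finset.mul_sum]
    exact mul_le_mul_of_nonneg_left (hG l) (hp l)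
  have h3 : Q ≤ ∑ i, ∑ j, (G i j) ^ 2 := by
    have : 0 ≤ ∑ i, ∑ j, (G i j - M i j) ^ 2 := by positivity
    have e : ∑ i, ∑ j, (G i j - M i j) ^ 2 = ∑ i, ∑ j, (G i j) ^ 2
        - 2 * ∑ i, ∑ j, G i j * M i j + ∑ i, ∑ j, M i j * M i j := by
      simp only [Finset.mul_sum, ← Finset.sum_add_distrib, ← Finset.sum_sub_distrib]
      refine Finset.sum_congr rfl fun i _ => Finset.sum_congr rfl fun j _ => by ring
    rw [e, hMM] at this
    linarith
  have h4 : 2 * (p k * p l * (D k l) ^ 2) ≤ Q - 2 * ∑ k, p k * D k k + K := by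
    have e : Q - 2 * ∑ k, p k * D k k + K
        = ∑ a, ∑ b, (if a = b then (p a * D a a - 1) ^ 2 else p a * (p b * (D b a) ^ 2)) := by
      have : ∀ a b : Fin K, (if a = b then (p a * D a a - 1) ^ 2 else p a * (p b * (D b a) ^ 2))
        = p a * (p b * (D b a) ^ 2) - 2 * (if a = b then p a * D a a else 0)
          + (if a = b then 1 else 0) := by
        intro a b
        split_ifs with h
        · subst h; ring
        · ring
      simp only [this, Finset.sum_add_distrib, Finset.sum_sub_distrib, ← Finset.mul_sum]
      simp [hQ, Finset.mul_sum]
    rw [e]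
    have hnn : ∀ a b : Fin K,
        0 ≤ (if a = b then (p a * D a a - 1) ^ 2 else p a * (p b * (D b a) ^ 2)) := by
      intro a b
      have := hp a
      have := hp b
      split_ifs <;> positivity
    have hs : D l k = D k l := by
      rw [hD, hD]; exact Finset.sum_congr rfl fun i _ => mul_comm _ _
    have ha : ∀ a b : Fin K, a ≠ b → p a * (p b * (D b a) ^ 2) ≤
        ∑ b, (if a = b then (p a * D a a - 1) ^ 2 else p a * (p b * (D b a) ^ 2)) := by
      intro a b hab
      have := Finset.single_le_sum (fun b _ => hnn a b) (Finset.mem_univ b)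
      simpa [hab] using this
    have h5 := Finset.sum_le_sum_of_subset_of_nonneg (Finset.subset_univ {k, l})
      (f := fun a => ∑ b,
        (if a = b then (p a * D a a - 1) ^ 2 else p a * (p b * (D b a) ^ 2)))
      (fun a _ _ => Finset.sum_nonneg (fun b _ => hnn a b))
    rw [Finset.sum_pair hkl] at h5
    have h6 := ha k l hkl
    have h7 := ha l k hkl.symm
    rw [hs] at h6
    nlinarith
  rw [h1]
  linarith

lemma aux_cs {Ω : Type*} [MeasurableSpace Ω] (P : Measure Ω) [IsProbabilityMeasure P]
    (C : Set Ω) (hC : MeasurableSet C) (hp : 0 < (P C).toReal) (h : Ω → ℝ)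
    (hi : Integrable h P) (hi2 : Integrable (fun x => h x ^ 2) P) (a : ℝ)
    (ha : (P C).toReal * a = ∫ x in C, h x ∂P) :
    (P C).toReal * a ^ 2 ≤ ∫ x in C, h x ^ 2 ∂P := by
  have h0 : 0 ≤ ∫ x in C, (h x - a) ^ 2 ∂P := integral_nonneg fun x => sq_nonneg _
  have e : ∫ x in C, (h x - a) ^ 2 ∂P
      = ∫ x in C, h x ^ 2 ∂P - 2 * a * ∫ x in C, h x ∂P + (P C).toReal * a ^ 2 := by
    have : ∀ x, (h x - a) ^ 2 = h x ^ 2 - 2 * a * h x + a ^ 2 := fun x => by ring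
    simp only [this]
    have i1 := hi.integrableOn (s := C)
    have i2 := hi2.integrableOn (s := C)
    have i4 : Integrable (fun x => h x ^ 2 - 2 * a * h x) (P.restrict C) :=
      i2.sub (i1.const_mul _)
    rw [integral_add i4 (integrable_const _),
      integral_sub i2 (i1.const_mul _), integral_const_mul]
    simp [Measure.real]
  rw [e, ← ha] at h0
  nlinarith

lemma aux_var {Ω : Type*} [MeasurableSpace Ω] (P : Measure Ω) [IsProbabilityMeasure P] {d : ℕ}
    (C : Set Ω) (hC : MeasurableSet C) (g : Ω → EuclideanSpace ℝ (Fin d))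
    (hi : Integrable g P) (hi2 : Integrable (fun x => ‖g x‖ ^ 2) P)
    (a : EuclideanSpace ℝ (Fin d))
    (ha : (P C).toReal • a = ∫ x in C, g x ∂P) (c : EuclideanSpace ℝ (Fin d)) :
    ∫ x in C, ‖g x‖ ^ 2 ∂P - (P C).toReal * ‖a‖ ^ 2 ≤ ∫ x in C, ‖g x - c‖ ^ 2 ∂P := by
  have i1 := hi.integrableOn (s := C)
  have i2 := hi2.integrableOn (s := C)
  have e : ∫ x in C, ‖g x - c‖ ^ 2 ∂P
      = ∫ x in C, ‖g x‖ ^ 2 ∂P - 2 * ((P C).toReal * inner ℝ c a)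
        + (P C).toReal * ‖c‖ ^ 2 := by
    have : ∀ x, ‖g x - c‖ ^ 2 = ‖g x‖ ^ 2 - 2 * inner ℝ c (g x) + ‖c‖ ^ 2 := fun x => by
      rw [norm_sub_sq_real, real_inner_comm]
    simp only [this]
    have i3 : Integrable (fun x => inner ℝ c (g x)) (P.restrict C) := i1.const_inner c
    have i4 : Integrable (fun x => ‖g x‖ ^ 2 - 2 * inner ℝ c (g x)) (P.restrict C) :=
      i2.sub (i3.const_mul _)
    rw [integral_add i4 (integrable_const _),
      integral_sub i2 (i3.const_mul _), integral_const_mul, integral_inner i1, ← ha,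
      inner_smul_right]
    simp [Measure.real]
  rw [e]
  have h1 : ‖c - a‖ ^ 2 = ‖c‖ ^ 2 - 2 * inner ℝ c a + ‖a‖ ^ 2 := norm_sub_sq_real c a
  have h2 : 0 ≤ (P C).toReal * ‖c - a‖ ^ 2 := by positivity
  rw [h1] at h2
  nlinarith

lemma aux_split {Ω : Type*} [MeasurableSpace Ω] (P : Measure Ω) [IsProbabilityMeasure P]
    (C B : Set Ω) (hC : MeasurableSet C) (hB : MeasurableSet B) (hBC : B ⊆ C)
    (h : Ω → ℝ) (hi : IntegrableOn h C P) (r s : ℝ)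
    (h1 : ∀ x ∈ B, h x ≤ r) (h2 : ∀ x, h x ≤ s) :
    ∫ x in C, h x ∂P ≤ (P B).toReal * r + ((P C).toReal - (P B).toReal) * s := by
  have e : ∫ x in C, h x ∂P = ∫ x in B, h x ∂P + ∫ x in C \ B, h x ∂P := by
    rw [← setIntegral_union Set.disjoint_sdiff_right (hC.diff hB) (hi.mono_set hBC)
      (hi.mono_set Set.sdiff_subset), Set.union_sdiff_cancel hBC]
  rw [e]
  have a1 : ∫ x in B, h x ∂P ≤ ∫ x in B, r ∂P :=
    setIntegral_mono_on (hi.mono_set hBC) (integrable_const _) hB h1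
  have a2 : ∫ x in C \ B, h x ∂P ≤ ∫ x in C \ B, s ∂P :=
    setIntegral_mono_on (hi.mono_set Set.sdiff_subset) (integrable_const _) (hC.diff hB)
      (fun x _ => h2 x)
  have e3 : P.real (C \ B) = P.real C - P.real B := measureReal_sdiff hBC hB
  simp only [integral_const, smul_eq_mul, measureReal_restrict_apply_univ] at a1 a2
  rw [e3] at a2
  exact add_le_add a1 a2

/-- Theorem 4.3: for a `√d`-norm `L`-Lipschitz encoder under a
`(σ,δ)`-augmentation, `(μ_kᵀμ_ℓ)² ≤ (2/(p_k p_ℓ))·(L₂(f) + τ'(ε,σ,δ) − (d−K)/2)`. -/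
theorem stmt_18 {N d K : ℕ}
    (P : Measure (EuclideanSpace ℝ (Fin N))) [IsProbabilityMeasure P]
    (A : EuclideanSpace ℝ (Fin N) → Set (EuclideanSpace ℝ (Fin N)))
    (hA : ∀ x, x ∈ A x)
    (ν : EuclideanSpace ℝ (Fin N) → Measure (EuclideanSpace ℝ (Fin N)))
    (hν : ∀ x, IsProbabilityMeasure (ν x))
    (hνsupp : ∀ x, (ν x) ((A x)ᶜ) = 0)
    (C C₀ : Fin K → Set (EuclideanSpace ℝ (Fin N)))
    (hCmeas : ∀ k, MeasurableSet (C k))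
    (hCdisj : ∀ k l, k ≠ l → Disjoint (C k) (C l))
    (hCtot : ∑ k, (P (C k)).toReal = 1)
    (hp : ∀ k, 0 < (P (C k)).toReal)
    (f : EuclideanSpace ℝ (Fin N) → EuclideanSpace ℝ (Fin d))
    (hfm : Measurable f)
    (hgint : Integrable (fun x => ∫ y, f y ∂(ν x)) P)
    (hnormalized : ∀ i : Fin d, ∫ x, ∫ y, (f y i) ^ 2 ∂(ν x) ∂P = 1)
    (L : ℝ) (hL : 0 ≤ L)
    (hnorm : ∀ x, ‖f x‖ = Real.sqrt d)
    (hLip : ∀ x₁ x₂, ‖f x₁ - f x₂‖ ≤ L * ‖x₁ - x₂‖)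
    (σ δ : ℝ) (hσ : 0 < σ) (hσ1 : σ ≤ 1) (hδ : 0 ≤ δ)
    (haug : IsSigmaDeltaAug P A C C₀ σ δ) :
    ∀ ε : ℝ, 0 < ε → ∀ k ℓ : Fin K, k ≠ ℓ →
      ((inner ℝ (center P ν (C k) f) (center P ν (C ℓ) f) : ℝ)) ^ 2
        ≤ (2 / ((P (C k)).toReal * (P (C ℓ)).toReal))
            * ((∑ i : Fin d, ∑ j : Fin d,
                  ((∫ x, ∫ y₁, ∫ y₂, (f y₁ i) * (f y₂ j) ∂(ν x) ∂(ν x) ∂P)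
                    - (if i = j then 1 else 0)) ^ 2)
              + (4 * (d : ℝ) * (1 - σ + (2 * ε + L * δ) / (2 * Real.sqrt d)) ^ 2
                + 4 * (1 - σ) * (d : ℝ)
                + 8 * (d : ℝ) * (K : ℝ) * (P ((goodSet A f ε)ᶜ)).toReal
                    * (3 / 2 - σ + (2 * ε + L * δ) / (2 * Real.sqrt d))
                + 4 * (d : ℝ) * ((P ((goodSet A f ε)ᶜ)).toReal) ^ 2
                    * (∑ k' : Fin K, 1 / (P (C k')).toReal)
                + Real.sqrt 2 * (d : ℝ) ^ ((3 : ℝ) / 4)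
                    * (∑ i : Fin d,
                        (1 - ∫ x, ∫ y₁, ∫ y₂, (f y₁ i) * (f y₂ i) ∂(ν x) ∂(ν x) ∂P) ^ 2)
                      ^ ((1 : ℝ) / 4))
              - ((d : ℝ) - (K : ℝ)) / 2) := by
  intro ε hε k ℓ hkl
  have := hν
  set g : EuclideanSpace ℝ (Fin N) → EuclideanSpace ℝ (Fin d) := fun x => ∫ y, f y ∂(ν x) with hg
  have hfint : ∀ x, Integrable f (ν x) := fun x =>
    Integrable.of_bound hfm.aestronglyMeasurable (Real.sqrt d)
      (Filter.Eventually.of_forall fun y => (hnorm y).le)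
  have hgi : ∀ x i, ∫ y, f y i ∂(ν x) = g x i := by
    intro x i
    exact ((EuclideanSpace.proj (𝕜 := ℝ) i).integral_comp_comm (hfint x))
  have hgn : ∀ x, ‖g x‖ ≤ Real.sqrt d := by
    intro x
    have := norm_integral_le_of_norm_le_const (μ := ν x) (f := f) (C := Real.sqrt d)
      (Filter.Eventually.of_forall fun y => (hnorm y).le)
    simpa using this
  have hint : ∀ i j, ∫ x, ∫ y₁, ∫ y₂, (f y₁ i) * (f y₂ j) ∂(ν x) ∂(ν x) ∂P
      = ∫ x, g x i * g x j ∂P := by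
    intro i j
    simp only [integral_const_mul, integral_mul_const, hgi]
  simp only [hint]
  have hgint' : Integrable g P := hgint
  have hgm := hgint'.aestronglyMeasurable
  have hsqd : Real.sqrt d ^ 2 = d := Real.sq_sqrt (Nat.cast_nonneg d)
  have hinn : ∀ v : EuclideanSpace ℝ (Fin d), Integrable (fun x => inner ℝ (g x) v) P :=
    fun v => hgint'.inner_const v
  have hcoord : ∀ i, Integrable (fun x => g x i) P := fun i =>
    (EuclideanSpace.proj (𝕜 := ℝ) i).integrable_comp hgint'
  have hgib : ∀ x i, ‖g x i‖ ≤ Real.sqrt d := fun x i =>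
    (PiLp.norm_apply_le (g x) i).trans (hgn x)
  have hgg : ∀ i j, Integrable (fun x => g x i * g x j) P := fun i j =>
    (hcoord j).bdd_mul (hcoord i).aestronglyMeasurable
      (Filter.Eventually.of_forall fun x => hgib x i)
  have hinn2 : ∀ v : EuclideanSpace ℝ (Fin d), Integrable (fun x => (inner ℝ (g x) v) ^ 2) P := by
    intro v
    simp only [sq]
    refine (hinn v).bdd_mul (c := Real.sqrt d * ‖v‖) (hinn v).aestronglyMeasurable
      (Filter.Eventually.of_forall fun x => ?_)
    exact (norm_inner_le_norm _ _).trans (mul_le_mul_of_nonneg_right (hgn x) (norm_nonneg _))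
  have hn2 : Integrable (fun x => ‖g x‖ ^ 2) P := by
    refine Integrable.of_bound (hgm.norm.pow 2) (d : ℝ) (Filter.Eventually.of_forall fun x => ?_)
    rw [Real.norm_of_nonneg (by positivity), ← hsqd]
    exact pow_le_pow_left₀ (norm_nonneg _) (hgn x) 2
  have hpart : ∀ h : EuclideanSpace ℝ (Fin N) → ℝ, Integrable h P →
      ∫ x, h x ∂P = ∑ k, ∫ x in C k, h x ∂P := by
    intro h hh
    have hd : Pairwise (Function.onFun Disjoint C) := fun a b hab => hCdisj a b hab
    rw [← integral_iUnion_fintype hCmeas hd (fun i => hh.integrableOn)]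
    have hm : P (⋃ k, C k) = 1 := by
      rw [measure_iUnion hd hCmeas, tsum_fintype]
      rw [← ENNReal.toReal_sum (fun a _ => measure_ne_top P _)] at hCtot
      exact (ENNReal.toReal_eq_one_iff _).1 hCtot
    have hae : ∀ᵐ x ∂P, x ∈ ⋃ k, C k :=
      (prob_compl_eq_zero_iff (MeasurableSet.iUnion hCmeas)).2 hm
    rw [Measure.restrict_eq_self_of_ae_mem hae]
  set p : Fin K → ℝ := fun k => (P (C k)).toReal with hpdef
  set m : Fin K → EuclideanSpace ℝ (Fin d) := fun k => center P ν (C k) f with hm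
  have hmc : ∀ k, (P (C k)).toReal • m k = ∫ x in C k, g x ∂P := by
    intro k
    simp only [hm, center]
    rw [setAverage_eq, smul_smul]
    have : (P (C k)).toReal * (P.real (C k))⁻¹ = 1 := mul_inv_cancel₀ (hp k).ne'
    rw [this, one_smul]
  have hinnsum : ∀ a b : EuclideanSpace ℝ (Fin d), inner ℝ a b = ∑ i, a i * b i := by
    intro a b
    rw [PiLp.inner_apply]
    refine Finset.sum_congr rfl fun i _ => ?_
    simp [mul_comm]
  set R : ℝ := (P ((goodSet A f ε)ᶜ)).toReal with hR
  have hR0 : 0 ≤ R := ENNReal.toReal_nonneg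
  set ρ : ℝ := 2 * ε + L * δ with hρ
  have hρ0 : 0 ≤ ρ := by positivity
  set B := toMeasurable P ((goodSet A f ε)ᶜ) with hB
  have hBm : MeasurableSet B := measurableSet_toMeasurable _ _
  have hBR : (P B).toReal = R := by rw [hB, measure_toMeasurable]
  have hBsub : ∀ x, x ∉ B → x ∈ goodSet A f ε := by
    intro x hx
    by_contra h
    exact hx (subset_toMeasurable P _ h)
  have hAne : ∀ x, ∀ᵐ y ∂(ν x), y ∈ A x := fun x => by
    rw [ae_iff]; exact hνsupp x
  have hgclose : ∀ x ∈ goodSet A f ε, ∀ y ∈ A x, ‖g x - f y‖ ≤ ε := by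
    intro x hx y hy
    have e : g x - f y = ∫ z, (f z - f y) ∂(ν x) := by
      rw [integral_sub (hfint x) (integrable_const _)]; simp [hg]
    rw [e]
    have := norm_integral_le_of_norm_le_const (μ := ν x) (f := fun z => f z - f y) (C := ε)
      ((hAne x).mono fun z hz => hx z hz y hy)
    simpa using this
  have hclose : ∀ k, ∀ x₁ ∈ C₀ k \ B, ∀ x₂ ∈ C₀ k \ B, ‖g x₁ - g x₂‖ ≤ ρ := by
    intro k x₁ hx₁ x₂ hx₂
    have hd := (haug k).2.2.2 x₁ hx₁.1 x₂ hx₂.1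
    refine le_of_forall_pos_le_add fun η hη => ?_
    have hη' : 0 < η / (L + 1) := by positivity
    have hne : {r : ℝ | ∃ y₁ ∈ A x₁, ∃ y₂ ∈ A x₂, r = ‖y₁ - y₂‖}.Nonempty :=
      ⟨_, x₁, hA x₁, x₂, hA x₂, rfl⟩
    obtain ⟨r, ⟨y₁, hy₁, y₂, hy₂, rfl⟩, hr⟩ := Real.lt_sInf_add_pos hne hη'
    have hr' : ‖y₁ - y₂‖ ≤ δ + η / (L + 1) := by
      have : sInf {r : ℝ | ∃ y₁ ∈ A x₁, ∃ y₂ ∈ A x₂, r = ‖y₁ - y₂‖} ≤ δ := hd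
      linarith
    have h1 := hgclose x₁ (hBsub _ hx₁.2) y₁ hy₁
    have h2 := hgclose x₂ (hBsub _ hx₂.2) y₂ hy₂
    have h3 := hLip y₁ y₂
    have h4 : L * ‖y₁ - y₂‖ ≤ L * δ + η := by
      have h5 := mul_le_mul_of_nonneg_left hr' hL
      have h6 : L * (η / (L + 1)) ≤ η := by
        rw [← mul_div_assoc, div_le_iff₀ (by positivity)]
        nlinarith
      linarith
    have e : g x₁ - g x₂ = (g x₁ - f y₁) + (f y₁ - f y₂) - (g x₂ - f y₂) := by abel
    rw [e]
    have h7 := norm_sub_le ((g x₁ - f y₁) + (f y₁ - f y₂)) (g x₂ - f y₂)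
    have h8 := norm_add_le (g x₁ - f y₁) (f y₁ - f y₂)
    linarith
  have hb4 : ∀ x (c : EuclideanSpace ℝ (Fin d)), ‖c‖ ≤ Real.sqrt d → ‖g x - c‖ ^ 2 ≤ 4 * d := by
    intro x c hc
    have h1 : ‖g x - c‖ ≤ 2 * Real.sqrt d := by
      have := norm_sub_le (g x) c
      have := hgn x
      linarith
    calc ‖g x - c‖ ^ 2 ≤ (2 * Real.sqrt d) ^ 2 := pow_le_pow_left₀ (norm_nonneg _) h1 2
      _ = 4 * d := by rw [mul_pow, hsqd]; norm_num
  have hVk : ∀ k, ∫ x in C k, ‖g x‖ ^ 2 ∂P - p k * ‖m k‖ ^ 2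
      ≤ p k * ρ ^ 2 + 4 * d * ((1 - σ) * p k + (P (C k ∩ B)).toReal) := by
    intro k
    have hC0 := haug k
    have hsub : C₀ k \ B ⊆ C k := Set.sdiff_subset.trans hC0.2.1
    have hmeas : MeasurableSet (C₀ k \ B) := hC0.1.diff hBm
    have hle : (P (C₀ k \ B)).toReal ≤ p k := measureReal_mono hsub
    have hge : σ * p k ≤ (P (C₀ k \ B)).toReal + (P (C k ∩ B)).toReal := by
      refine hC0.2.2.1.trans ?_
      have h1 : P.real (C₀ k) ≤ P.real ((C₀ k \ B) ∪ (C k ∩ B)) := by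
        refine measureReal_mono fun x hx => ?_
        by_cases hxB : x ∈ B
        · exact Or.inr ⟨hC0.2.1 hx, hxB⟩
        · exact Or.inl ⟨hx, hxB⟩
      exact h1.trans (measureReal_union_le _ _)
    obtain ⟨c, hc, hcρ⟩ : ∃ c : EuclideanSpace ℝ (Fin d), ‖c‖ ≤ Real.sqrt d ∧
        ∀ x ∈ C₀ k \ B, ‖g x - c‖ ^ 2 ≤ ρ ^ 2 := by
      rcases (C₀ k \ B).eq_empty_or_nonempty with he | ⟨x₀, hx₀⟩
      · exact ⟨0, by simp, by simp [he]⟩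
      · exact ⟨g x₀, hgn x₀, fun x hx =>
          pow_le_pow_left₀ (norm_nonneg _) (hclose k x hx x₀ hx₀) 2⟩
    have h1 := aux_var P (C k) (hCmeas k) g hgint' hn2 (m k) (hmc k) c
    have hi : Integrable (fun x => ‖g x - c‖ ^ 2) P := by
      refine Integrable.of_bound ((hgm.sub aestronglyMeasurable_const).norm.pow 2) (4 * d : ℝ)
        (Filter.Eventually.of_forall fun x => ?_)
      rw [Real.norm_of_nonneg (by positivity)]
      exact hb4 x c hc
    have h2 := aux_split P (C k) (C₀ k \ B) (hCmeas k) hmeas hsub (fun x => ‖g x - c‖ ^ 2)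
      hi.integrableOn (ρ ^ 2) (4 * d) hcρ (fun x => hb4 x c hc)
    have h3 : (P (C₀ k \ B)).toReal * ρ ^ 2 ≤ p k * ρ ^ 2 :=
      mul_le_mul_of_nonneg_right hle (by positivity)
    have h4 : (p k - (P (C₀ k \ B)).toReal) * (4 * d)
        ≤ ((1 - σ) * p k + (P (C k ∩ B)).toReal) * (4 * d) :=
      mul_le_mul_of_nonneg_right (by linarith) (by positivity)
    have h1' : ∫ x in C k, ‖g x‖ ^ 2 ∂P - p k * ‖m k‖ ^ 2 ≤ ∫ x in C k, ‖g x - c‖ ^ 2 ∂P := h1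
    have h2' : ∫ x in C k, ‖g x - c‖ ^ 2 ∂P ≤ (P (C₀ k \ B)).toReal * ρ ^ 2
        + (p k - (P (C₀ k \ B)).toReal) * (4 * d) := h2
    linarith
  have hBsum : ∑ k, (P (C k ∩ B)).toReal ≤ R := by
    have h1 := measureReal_biUnion_finset (μ := P) (s := Finset.univ) (f := fun k => C k ∩ B)
      (fun a _ b _ hab => (hCdisj a b hab).mono Set.inter_subset_left Set.inter_subset_left)
      (fun a _ => (hCmeas a).inter hBm)
    have h2 : P.real (⋃ b ∈ Finset.univ, C b ∩ B) ≤ P.real B :=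
      measureReal_mono (by simp)
    rw [h1] at h2
    exact h2.trans hBR.le
  have hV : ∫ x, ‖g x‖ ^ 2 ∂P - ∑ k, p k * ‖m k‖ ^ 2 ≤ ρ ^ 2 + 4 * d * (1 - σ) + 4 * d * R := by
    rw [hpart _ hn2, ← Finset.sum_sub_distrib]
    refine (Finset.sum_le_sum fun k _ => hVk k).trans ?_
    rw [Finset.sum_add_distrib, ← Finset.sum_mul, ← Finset.mul_sum, Finset.sum_add_distrib,
      ← Finset.mul_sum]
    have : ∑ k, p k = 1 := hCtot
    rw [this]
    have := mul_le_mul_of_nonneg_left hBsum (show (0:ℝ) ≤ 4 * d by positivity)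
    linarith
  have hG : ∀ l, ∑ k, p k * (inner ℝ (m k) (m l)) ^ 2
      ≤ ∑ i, ∑ j, (∫ x, g x i * g x j ∂P) * (m l i * m l j) := by
    intro l
    have e : ∑ i, ∑ j, (∫ x, g x i * g x j ∂P) * (m l i * m l j)
        = ∫ x, (inner ℝ (g x) (m l)) ^ 2 ∂P := by
      have e1 : ∀ x, (inner ℝ (g x) (m l)) ^ 2
          = ∑ i, ∑ j, (g x i * g x j) * (m l i * m l j) := by
        intro x
        rw [hinnsum, sq, Finset.sum_mul_sum]
        refine Finset.sum_congr rfl fun i _ => Finset.sum_congr rfl fun j _ => by ring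
      simp only [e1]
      rw [integral_finsetSum _ (fun i _ => integrable_finsetSum _
        (fun j _ => (hgg i j).mul_const _))]
      refine Finset.sum_congr rfl fun i _ => ?_
      rw [integral_finsetSum _ (fun j _ => (hgg i j).mul_const _)]
      refine Finset.sum_congr rfl fun j _ => ?_
      rw [integral_mul_const]
    rw [e, hpart _ (hinn2 (m l))]
    refine Finset.sum_le_sum fun k _ => ?_
    refine aux_cs P (C k) (hCmeas k) (hp k) (fun x => inner ℝ (g x) (m l)) (hinn _) (hinn2 _) _ ?_
    have h1 : ∫ x in C k, inner ℝ (m l) (g x) ∂P = inner ℝ (m l) (∫ x in C k, g x ∂P) :=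
      integral_inner hgint'.integrableOn (m l)
    rw [← hmc k, inner_smul_right] at h1
    simp only [real_inner_comm (m l)]
    rw [h1]
  have htr : ∑ i, ∫ x, g x i * g x i ∂P = ∫ x, ‖g x‖ ^ 2 ∂P := by
    rw [← integral_finsetSum _ (fun i _ => hgg i i)]
    refine integral_congr_ae (Filter.Eventually.of_forall fun x => ?_)
    show _ = ‖g x‖ ^ 2
    rw [← real_inner_self_eq_norm_sq, hinnsum]
  set V : ℝ := ∫ x, ‖g x‖ ^ 2 ∂P - ∑ k, p k * ‖m k‖ ^ 2 with hVdef
  have hmain := aux_alg (fun i j => ∫ x, g x i * g x j ∂P) p (fun k => (hp k).le)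
    (fun k i => m k i) (fun k l => inner ℝ (m k) (m l)) (fun k l => hinnsum _ _) hG V
    (by
      rw [htr]
      simp only [real_inner_self_eq_norm_sq]
      exact le_refl _) k ℓ hkl
  have hK : (1 : ℝ) ≤ K := by
    have : 0 < K := Fin.pos k
    exact_mod_cast this
  set L2 : ℝ := ∑ i : Fin d, ∑ j : Fin d,
    ((∫ x, g x i * g x j ∂P) - (if i = j then 1 else 0)) ^ 2 with hL2
  have hL20 : 0 ≤ L2 := by positivity
  set T4 : ℝ := 4 * (d : ℝ) * R ^ 2 * (∑ k' : Fin K, 1 / p k')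
  have hT4 : 0 ≤ T4 := mul_nonneg (by positivity)
    (Finset.sum_nonneg fun k _ => one_div_nonneg.2 (hp k).le)
  set T5 : ℝ := Real.sqrt 2 * (d : ℝ) ^ ((3 : ℝ) / 4)
    * (∑ i : Fin d, (1 - ∫ x, g x i * g x i ∂P) ^ 2) ^ ((1 : ℝ) / 4)
  have hT5 : 0 ≤ T5 := by positivity
  set q : ℝ := ρ / (2 * Real.sqrt d) with hq
  have hq0 : 0 ≤ q := by positivity
  have hT3 : 4 * d * R ≤ 8 * (d : ℝ) * K * R * (3 / 2 - σ + q) := by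
    have h1 : (1:ℝ) / 2 ≤ 3 / 2 - σ + q := by linarith
    have h2 : (1:ℝ) * (1 / 2) ≤ K * (3 / 2 - σ + q) :=
      mul_le_mul hK h1 (by norm_num) (by positivity)
    have h3 := mul_le_mul_of_nonneg_left h2 (show 0 ≤ 8 * d * R by positivity)
    linarith
  have hVτ : V ≤ 4 * (d : ℝ) * (1 - σ + q) ^ 2 + 4 * (1 - σ) * (d : ℝ)
      + 8 * (d : ℝ) * K * R * (3 / 2 - σ + q) + T4 + T5 := by
    rcases Nat.eq_zero_or_pos d with h0 | hpos
    · have hd0 : (d : ℝ) = 0 := by rw [h0]; simp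
      have hg0 : ∀ x, ‖g x‖ = 0 := fun x => by
        have := hgn x
        rw [hd0, Real.sqrt_zero] at this
        exact le_antisymm this (norm_nonneg _)
      have hV0 : V ≤ 0 := by
        rw [hVdef]
        simp only [hg0]
        have : 0 ≤ ∑ k, p k * ‖m k‖ ^ 2 :=
          Finset.sum_nonneg fun k _ => mul_nonneg (hp k).le (by positivity)
        simpa using this
      rw [hd0]
      linarith
    · have hd0 : (0 : ℝ) < d := by exact_mod_cast hpos
      have hs0 : 0 < Real.sqrt d := Real.sqrt_pos.2 hd0
      have hρq : ρ ^ 2 = 4 * d * q ^ 2 := by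
        rw [hq, div_pow, mul_pow, hsqd]
        field_simp
        norm_num
      have h1 : q ^ 2 ≤ (1 - σ + q) ^ 2 := pow_le_pow_left₀ hq0 (by linarith) 2
      have h2 := mul_le_mul_of_nonneg_left h1 (show (0:ℝ) ≤ 4 * d by positivity)
      linarith
  have hpp : 0 < p k * p ℓ := mul_pos (hp k) (hp ℓ)
  have hfin : p k * p ℓ * (inner ℝ (m k) (m ℓ)) ^ 2 ≤ 2 * (L2 + (4 * (d : ℝ) * (1 - σ + q) ^ 2
      + 4 * (1 - σ) * (d : ℝ)
      + 8 * (d : ℝ) * K * R * (3 / 2 - σ + q) + T4 + T5) - ((d : ℝ) - K) / 2) := by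
    have h0 : 0 ≤ p k * p ℓ * (inner ℝ (m k) (m ℓ)) ^ 2 := by positivity
    linarith
  show (inner ℝ (m k) (m ℓ)) ^ 2 ≤ 2 / (p k * p ℓ) * _
  rw [div_mul_eq_mul_div, le_div_iff₀ hpp, mul_comm]
  exact hfin
end
end
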